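/- arXiv:2603.11292 — 11 statements merged into one kernel-verified Lean document; each statement's English description precedes it below -/
import Mathlib

section
/- Define R(b,S,τ) = exp((τ/2)·((1+b)² + (1−b−S)²)) and F(S) = τ·R(b,S,τ)^(γ−1)·(1−b−S), for fixed real b, τ > 0 and γ > 1. Then for every real S, F is differentiable at S with F′(S) = −τ·R(b,S,τ)^(γ−1)·(1 + (γ−1)·τ·(1−b−S)²), and F′(S) < 0; in particular F is strictly decreasing on ℝ. -/
noncomputable def R (b S τ : ℝ) : ℝ := Real.exp (τ / 2 * ((1 + b) ^ 2 + (1 - b - S) ^ 2))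

theorem stmt3 (b τ γ : ℝ) (hτ : 0 < τ) (hγ : 1 < γ) :
    (∀ S : ℝ,
      HasDerivAt (fun S' => τ * R b S' τ ^ (γ - 1) * (1 - b - S'))
        (-(τ * R b S τ ^ (γ - 1) * (1 + (γ - 1) * τ * (1 - b - S) ^ 2))) S ∧
      -(τ * R b S τ ^ (γ - 1) * (1 + (γ - 1) * τ * (1 - b - S) ^ 2)) < 0) ∧
    StrictAnti (fun S => τ * R b S τ ^ (γ - 1) * (1 - b - S)) := by
  have key : ∀ S : ℝ,
      HasDerivAt (fun S' => τ * R b S' τ ^ (γ - 1) * (1 - b - S'))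
        (-(τ * R b S τ ^ (γ - 1) * (1 + (γ - 1) * τ * (1 - b - S) ^ 2))) S ∧
      -(τ * R b S τ ^ (γ - 1) * (1 + (γ - 1) * τ * (1 - b - S) ^ 2)) < 0 := by
    intro S
    constructor
    · unfold R
      simp only [← Real.exp_mul]
      have h1 : HasDerivAt (fun x : ℝ => 1 - b - x) (-1) S := by
        simpa using (hasDerivAt_id S).const_sub (1 - b)
      have h2 := ((((h1.fun_pow 2).const_add ((1 + b) ^ 2)).const_mul (τ / 2)).mul_const
        (γ - 1)).exp
      have h3 := (h2.const_mul τ).fun_mul h1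
      refine h3.congr_deriv ?_
      push_cast
      ring
    · have hR : 0 < R b S τ ^ (γ - 1) := Real.rpow_pos_of_pos (Real.exp_pos _) _
      have h0 : 0 < γ - 1 := by linarith
      have : 0 < τ * R b S τ ^ (γ - 1) * (1 + (γ - 1) * τ * (1 - b - S) ^ 2) := by positivity
      linarith
  refine ⟨key, strictAnti_of_deriv_neg fun S => ?_⟩
  rw [(key S).1.deriv]
  exact (key S).2
end

section
/- Define R(b,S,τ) = exp((τ/2)·((1+b)² + (1−b−S)²)) and F(S) = τ·R(b,S,τ)^(γ−1)·(1−b−S). Suppose τ > 0, γ > 1, 0 ≤ b < 1, and 0 < h < τ·exp((τ·(γ−1)/2)·((1+b)² + (1−b)²))·(1−b). Then there exists a unique S* ∈ (0, 1−b) such that F(S*) = h. -/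
theorem stmt4 (b τ γ h : ℝ) (hτ : 0 < τ) (hγ : 1 < γ) (hb0 : 0 ≤ b) (hb1 : b < 1)
    (hh0 : 0 < h)
    (hh1 : h < τ * Real.exp (τ * (γ - 1) / 2 * ((1 + b) ^ 2 + (1 - b) ^ 2)) * (1 - b)) :
    ∃! S : ℝ, S ∈ Set.Ioo 0 (1 - b) ∧ τ * R b S τ ^ (γ - 1) * (1 - b - S) = h := by
  have hR : ∀ S : ℝ, R b S τ ^ (γ - 1) =
      Real.exp (τ * (γ - 1) / 2 * ((1 + b) ^ 2 + (1 - b - S) ^ 2)) := by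
    intro S
    rw [R, ← Real.exp_mul]
    congr 1
    ring
  simp only [hR]
  have hc : 0 < τ * (γ - 1) / 2 := by
    have : 0 < γ - 1 := by linarith
    positivity
  generalize τ * (γ - 1) / 2 = c at hc hh1
  have hanti : ∀ x y : ℝ, x < y → y < 1 - b →
      τ * Real.exp (c * ((1 + b) ^ 2 + (1 - b - y) ^ 2)) * (1 - b - y) <
      τ * Real.exp (c * ((1 + b) ^ 2 + (1 - b - x) ^ 2)) * (1 - b - x) := by
    intro x y hxy hy
    have h1 : Real.exp (c * ((1 + b) ^ 2 + (1 - b - y) ^ 2)) ≤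
        Real.exp (c * ((1 + b) ^ 2 + (1 - b - x) ^ 2)) := by
      apply Real.exp_le_exp.mpr
      apply mul_le_mul_of_nonneg_left _ hc.le
      nlinarith
    apply mul_lt_mul' (mul_le_mul_of_nonneg_left h1 hτ.le) (by linarith) (by linarith)
    positivity
  have hcont : ContinuousOn
      (fun S : ℝ => τ * Real.exp (c * ((1 + b) ^ 2 + (1 - b - S) ^ 2)) * (1 - b - S))
      (Set.Icc 0 (1 - b)) := by fun_prop
  obtain ⟨S, hS, hSe⟩ := intermediate_value_Ioo' (by linarith) hcont
    (show h ∈ Set.Ioo _ _ from ⟨by simpa using hh0, by simpa using hh1⟩)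
  refine ⟨S, ⟨hS, hSe⟩, ?_⟩
  rintro T ⟨hT, hTe⟩
  simp only at hSe
  rcases lt_trichotomy T S with hlt | heq | hgt
  · have := hanti T S hlt hS.2
    linarith
  · exact heq
  · have := hanti S T hgt hT.2
    linarith
end

section
/- Let τ > 0 and let a, b, c be real numbers with −1 ≤ a < b < c ≤ 1 and 0 < b < 1. Define R₁(x) = exp((τ/2)·((1+a)² + (1−x)²)) and R₂(x) = exp((τ/2)·((1+x)² + (1−c)²)). Then (|R₂′(b)| / R₂(b)) / (|R₁′(b)| / R₁(b)) = (1+b)/(1−b), which is strictly greater than 1; moreover, the function T(b) = (1+b)/(1−b) is differentiable on (0,1) with T′(b) = 2/(1−b)² > 0. -/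
theorem stmt8 (τ a b c : ℝ) (hτ : 0 < τ) (h1 : -1 ≤ a) (h2 : a < b) (h3 : b < c)
    (h4 : c ≤ 1) (hb0 : 0 < b) (hb1 : b < 1) :
    (|deriv (fun x => Real.exp (τ / 2 * ((1 + x) ^ 2 + (1 - c) ^ 2))) b| /
        Real.exp (τ / 2 * ((1 + b) ^ 2 + (1 - c) ^ 2))) /
      (|deriv (fun x => Real.exp (τ / 2 * ((1 + a) ^ 2 + (1 - x) ^ 2))) b| /
        Real.exp (τ / 2 * ((1 + a) ^ 2 + (1 - b) ^ 2))) = (1 + b) / (1 - b) ∧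
    1 < (1 + b) / (1 - b) ∧
    ∀ x ∈ Set.Ioo (0 : ℝ) 1,
      HasDerivAt (fun y => (1 + y) / (1 - y)) (2 / (1 - x) ^ 2) x ∧ 0 < 2 / (1 - x) ^ 2 := by
  have hid : HasDerivAt (fun x : ℝ => x) 1 b := hasDerivAt_id b
  have d2 : HasDerivAt (fun x => Real.exp (τ / 2 * ((1 + x) ^ 2 + (1 - c) ^ 2)))
      (Real.exp (τ / 2 * ((1 + b) ^ 2 + (1 - c) ^ 2)) * (τ * (1 + b))) b := by
    refine (((((hid.const_add 1).pow 2).add_const ((1 - c) ^ 2)).const_mul (τ / 2)).exp).congr_deriv ?_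
    refine congrArg₂ (· * ·) rfl ?_
    norm_num
    ring
  have d1 : HasDerivAt (fun x => Real.exp (τ / 2 * ((1 + a) ^ 2 + (1 - x) ^ 2)))
      (Real.exp (τ / 2 * ((1 + a) ^ 2 + (1 - b) ^ 2)) * (-(τ * (1 - b)))) b := by
    refine (((((hid.const_sub 1).pow 2).const_add ((1 + a) ^ 2)).const_mul (τ / 2)).exp).congr_deriv ?_
    refine congrArg₂ (· * ·) rfl ?_
    norm_num
    ring
  have hb : 0 < 1 - b := by linarith
  have hb' : 0 < 1 + b := by linarith
  refine ⟨?_, ?_, ?_⟩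
  · rw [d2.deriv, d1.deriv, abs_mul (Real.exp _) (τ * (1 + b)),
      abs_mul (Real.exp _) (-(τ * (1 - b))), abs_neg, Real.abs_exp, Real.abs_exp,
      abs_of_pos (mul_pos hτ hb), abs_of_pos (mul_pos hτ hb'),
      mul_div_cancel_left₀ _ (Real.exp_pos _).ne', mul_div_cancel_left₀ _ (Real.exp_pos _).ne',
      mul_div_mul_left _ _ hτ.ne']
  · rw [lt_div_iff₀ hb]
    linarith
  · rintro x ⟨hx0, hx1⟩
    have hx : 0 < 1 - x := by linarith
    refine ⟨?_, by positivity⟩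
    have hi : HasDerivAt (fun x : ℝ => x) 1 x := hasDerivAt_id x
    refine ((hi.const_add 1).div (hi.const_sub 1) hx.ne').congr_deriv ?_
    congr 1
    ring
end

section
/- Define R(b,S,τ) = exp((τ/2)·((1+b)² + (1−b−S)²)) and F(b,S,τ,γ,h) = τ·R(b,S,τ)^(γ−1)·(1−b−S) − h. Suppose γ > 1, τ > 0, b ≥ 0, S > 0, and b + S < 1. Then the partial derivative of F with respect to τ equals R(b,S,τ)^(γ−1)·(1−b−S)·(1 + (τ·(γ−1)/2)·((1+b)² + (1−b−S)²)), and it is strictly positive. -/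
theorem stmt9 (b S τ γ h : ℝ) (hγ : 1 < γ) (hτ : 0 < τ) (hb : 0 ≤ b) (hS : 0 < S)
    (hbS : b + S < 1) :
    HasDerivAt (fun τ' => τ' * R b S τ' ^ (γ - 1) * (1 - b - S) - h)
      (R b S τ ^ (γ - 1) * (1 - b - S) *
        (1 + τ * (γ - 1) / 2 * ((1 + b) ^ 2 + (1 - b - S) ^ 2))) τ ∧
    0 < R b S τ ^ (γ - 1) * (1 - b - S) *
        (1 + τ * (γ - 1) / 2 * ((1 + b) ^ 2 + (1 - b - S) ^ 2)) := by
  have hx : 0 < 1 - b - S := by linarith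
  have hg : 0 < γ - 1 := by linarith
  have hR : ∀ t, R b S t ^ (γ - 1) =
      Real.exp (t * ((γ - 1) / 2 * ((1 + b) ^ 2 + (1 - b - S) ^ 2))) := by
    intro t
    unfold R
    rw [← Real.exp_mul]
    congr 1
    ring
  simp only [hR]
  constructor
  · have h1 := ((hasDerivAt_id τ).mul_const
      ((γ - 1) / 2 * ((1 + b) ^ 2 + (1 - b - S) ^ 2))).exp
    have h2 := (((hasDerivAt_id τ).mul h1).mul_const (1 - b - S)).sub_const h
    refine h2.congr_deriv ?_
    simp only [id]
    ring
  · positivity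
end

section
/- Let γ > 1, τ > 0, and 0 ≤ a < 1 be real numbers. Define φ(x) = exp((τ·(γ−1)/2)·((1+a)² + (1−x)²))·(1−x)·(1 + (τ·(γ−1)/2)·((1+a)² + (1−x)²)). Then φ is strictly decreasing on the interval [a, 1). -/
theorem stmt10 (γ τ a : ℝ) (hγ : 1 < γ) (hτ : 0 < τ) (ha0 : 0 ≤ a) (ha1 : a < 1) :
    StrictAntiOn
      (fun x => Real.exp (τ * (γ - 1) / 2 * ((1 + a) ^ 2 + (1 - x) ^ 2)) * (1 - x) *
        (1 + τ * (γ - 1) / 2 * ((1 + a) ^ 2 + (1 - x) ^ 2)))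
      (Set.Ico a 1) := by
  intro x hx y hy hxy
  have hc : 0 < τ * (γ - 1) / 2 := by
    have : 0 < γ - 1 := by linarith
    positivity
  have hy1 : 0 < 1 - y := by linarith [hy.2]
  have hx1 : 0 < 1 - x := by linarith
  have hs : (1 + a) ^ 2 + (1 - y) ^ 2 < (1 + a) ^ 2 + (1 - x) ^ 2 := by nlinarith
  have hm := mul_lt_mul_of_pos_left hs hc
  have hpos : 0 < τ * (γ - 1) / 2 * ((1 + a) ^ 2 + (1 - y) ^ 2) := by positivity
  have he := Real.exp_lt_exp.2 hm
  have h1 := mul_lt_mul'' he (by linarith : 1 - y < 1 - x) (Real.exp_pos _).le hy1.le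
  exact mul_lt_mul'' h1 (by linarith) (by positivity) (by linarith)
end

section
/- Define R(b,S,τ) = exp((τ/2)·((1+b)² + (1−b−S)²)). Let γ > 1, τ > 0, h > 0, let I be an open interval contained in [0,1), and let S : I → ℝ be differentiable with 0 < S(b) and b + S(b) < 1 for all b ∈ I. Suppose that for all b ∈ I, τ·R(b, S(b), τ)^(γ−1)·(1 − b − S(b)) = h and τ·(γ−1)·(2b + S(b))·(1 − b − S(b)) > 1. Then S′(b) > 0 for all b ∈ I. -/
theorem stmt12 (γ τ h p q : ℝ) (hγ : 1 < γ) (hτ : 0 < τ) (hh : 0 < h)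
    (hI : Set.Ioo p q ⊆ Set.Ico (0 : ℝ) 1) (S : ℝ → ℝ)
    (hS : ∀ b ∈ Set.Ioo p q, DifferentiableAt ℝ S b)
    (hpos : ∀ b ∈ Set.Ioo p q, 0 < S b ∧ b + S b < 1)
    (hfoc : ∀ b ∈ Set.Ioo p q, τ * R b (S b) τ ^ (γ - 1) * (1 - b - S b) = h)
    (hcond : ∀ b ∈ Set.Ioo p q, 1 < τ * (γ - 1) * (2 * b + S b) * (1 - b - S b)) :
    ∀ b ∈ Set.Ioo p q, 0 < deriv S b := by
  intro b hb
  have hd := (hS b hb).hasDerivAt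
  set s := deriv S b with hs
  have hx : HasDerivAt (fun y => 1 - y - S y) (-1 - s) b := by
    have := ((hasDerivAt_id b).const_sub 1).sub hd
    exact this
  have hy : HasDerivAt (fun y : ℝ => 1 + y) 1 b := (hasDerivAt_id b).const_add 1
  have hE := ((((hy.pow 2).add (hx.pow 2)).const_mul (τ / 2)).mul_const (γ - 1)).exp
  have hF := (hE.const_mul τ).mul hx
  have hc : HasDerivAt (fun _ : ℝ => h) 0 b := hasDerivAt_const b h
  have hc' := hc.congr_of_eventuallyEq (f₁ := fun y => τ * Real.exp (τ / 2 * ((1 + y) ^ 2 + (1 - y - S y) ^ 2) * (γ - 1)) * (1 - y - S y)) (by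
    filter_upwards [Ioo_mem_nhds hb.1 hb.2] with y hy
    have := hfoc y hy
    rw [R, ← Real.exp_mul] at this
    exact this)
  have hu := hF.unique hc'
  simp only [Pi.add_apply, Pi.pow_apply] at hu
  have hEp := Real.exp_pos (τ / 2 * ((1 + b) ^ 2 + (1 - b - S b) ^ 2) * (γ - 1))
  set E := Real.exp (τ / 2 * ((1 + b) ^ 2 + (1 - b - S b) ^ 2) * (γ - 1)) with hEdef
  have hcb := hcond b hb
  have key : (τ * E) * (s * (τ * (γ - 1) * (1 - b - S b) ^ 2 + 1)
      - (τ * (γ - 1) * (2 * b + S b) * (1 - b - S b) - 1)) = 0 := by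
    norm_num at hu
    linear_combination -hu
  have h2 := (mul_eq_zero.mp key).resolve_left (mul_pos hτ hEp).ne'
  have h3 : 0 < τ * (γ - 1) * (1 - b - S b) ^ 2 + 1 := by
    have : 0 < γ - 1 := by linarith
    positivity
  exact pos_of_mul_pos_left (b := τ * (γ - 1) * (1 - b - S b) ^ 2 + 1) (by linarith) h3.le
end

section
/- Define R(b,S,τ) = exp((τ/2)·((1+b)² + (1−b−S)²)). Let γ > 1, h > 0, 0 ≤ b < 1, let I ⊆ (0,∞) be an open interval, and let S : I → ℝ be differentiable with 0 < S(τ) and b + S(τ) < 1 for all τ ∈ I. Suppose that for all τ ∈ I, τ·R(b, S(τ), τ)^(γ−1)·(1 − b − S(τ)) = h. Then S′(τ) > 0 for all τ ∈ I. -/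
theorem stmt14 (γ h b p q : ℝ) (hγ : 1 < γ) (hh : 0 < h) (hb0 : 0 ≤ b) (hb1 : b < 1)
    (hI : Set.Ioo p q ⊆ Set.Ioi (0 : ℝ)) (S : ℝ → ℝ)
    (hS : ∀ τ ∈ Set.Ioo p q, DifferentiableAt ℝ S τ)
    (hpos : ∀ τ ∈ Set.Ioo p q, 0 < S τ ∧ b + S τ < 1)
    (hfoc : ∀ τ ∈ Set.Ioo p q, τ * R b (S τ) τ ^ (γ - 1) * (1 - b - S τ) = h) :
    ∀ τ ∈ Set.Ioo p q, 0 < deriv S τ := by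
  intro τ hτ
  have ht : 0 < τ := hI hτ
  have hx : 0 < 1 - b - S τ := by linarith [(hpos τ hτ).2]
  have hd := (hS τ hτ).hasDerivAt
  have hX : HasDerivAt (fun t => 1 - b - S t) (-deriv S τ) τ := hd.const_sub (1 - b)
  have hQ : HasDerivAt (fun t => (1 + b) ^ 2 + (1 - b - S t) ^ 2)
      (2 * (1 - b - S τ) * (-deriv S τ)) τ := by
    have := (hX.pow 2).const_add ((1 + b) ^ 2)
    simpa using this
  have hE := ((((hasDerivAt_id τ).div_const 2).mul hQ).mul_const (γ - 1)).exp
  have hG := ((hasDerivAt_id τ).mul hE).mul hX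
  have hc : HasDerivAt (fun _ : ℝ => h) 0 τ := hasDerivAt_const τ h
  have hev := hc.congr_of_eventuallyEq (f₁ := fun t => t * R b (S t) t ^ (γ - 1) * (1 - b - S t))
    (by filter_upwards [isOpen_Ioo.mem_nhds hτ] with t h1 using hfoc t h1)
  simp only [R, ← Real.exp_mul] at hev
  have key := hG.unique hev
  simp only [id, Pi.mul_apply] at key
  set D := deriv S τ
  set x := 1 - b - S τ
  have he := Real.exp_pos (τ / 2 * ((1 + b) ^ 2 + x ^ 2) * (γ - 1))
  set e := Real.exp (τ / 2 * ((1 + b) ^ 2 + x ^ 2) * (γ - 1))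
  have k2 : e * (D * (τ * (1 + τ * (γ - 1) * x ^ 2))) = e * (x + τ * (γ - 1) * x * ((1 + b) ^ 2 + x ^ 2) / 2) := by
    linear_combination -key
  have k3 := mul_left_cancel₀ he.ne' k2
  have hg : 0 < γ - 1 := by linarith
  have p1 : 0 < τ * (1 + τ * (γ - 1) * x ^ 2) := by positivity
  have p2 : 0 < x + τ * (γ - 1) * x * ((1 + b) ^ 2 + x ^ 2) / 2 := by positivity
  rw [← k3] at p2
  exact pos_of_mul_pos_left p2 p1.le
end

section
/- Define R(b,S,τ) = exp((τ/2)·((1+b)² + (1−b−S)²)). Let γ > 1, τ > 0, 0 ≤ b < 1, let I ⊆ (0,∞) be an open interval, and let S : I → ℝ be differentiable with 0 < S(h) and b + S(h) < 1 for all h ∈ I. Suppose that for all h ∈ I, τ·R(b, S(h), τ)^(γ−1)·(1 − b − S(h)) = h. Then S′(h) < 0 for all h ∈ I. -/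
theorem stmt15 (γ τ b p q : ℝ) (hγ : 1 < γ) (hτ : 0 < τ) (hb0 : 0 ≤ b) (hb1 : b < 1)
    (hI : Set.Ioo p q ⊆ Set.Ioi (0 : ℝ)) (S : ℝ → ℝ)
    (hS : ∀ h ∈ Set.Ioo p q, DifferentiableAt ℝ S h)
    (hpos : ∀ h ∈ Set.Ioo p q, 0 < S h ∧ b + S h < 1)
    (hfoc : ∀ h ∈ Set.Ioo p q, τ * R b (S h) τ ^ (γ - 1) * (1 - b - S h) = h) :
    ∀ h ∈ Set.Ioo p q, deriv S h < 0 := by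
  intro h hh
  have hd := (hS h hh).hasDerivAt
  have hu : HasDerivAt (fun x => 1 - b - S x) (-deriv S h) h := hd.const_sub (1 - b)
  have hE := ((((hu.pow 2).const_add ((1 + b) ^ 2)).const_mul (τ / 2)).mul_const (γ - 1)).exp
  have hF := (hE.const_mul τ).mul hu
  have hid : HasDerivAt (fun x : ℝ => x) 1 h := hasDerivAt_id h
  have hG := hid.congr_of_eventuallyEq (f₁ := fun x => τ * R b (S x) τ ^ (γ - 1) * (1 - b - S x))
    (by
      filter_upwards [isOpen_Ioo.mem_nhds hh] with x hx
      exact hfoc x hx)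
  simp only [R, ← Real.exp_mul] at hG
  have key := hF.unique hG
  simp only [Pi.pow_apply] at key
  by_contra hn
  push Not at hn
  set E := Real.exp (τ / 2 * ((1 + b) ^ 2 + (1 - b - S h) ^ 2) * (γ - 1)) with hEdef
  have hEpos : 0 < E := Real.exp_pos _
  have h1 : 0 ≤ deriv S h * (τ * E * ((γ - 1) * τ * (1 - b - S h) ^ 2 + 1)) := by
    have : 0 < γ - 1 := by linarith
    positivity
  norm_num at key
  nlinarith [key, h1]
end

section
/- Define R(b,S,τ) = exp((τ/2)·((1+b)² + (1−b−S)²)) and F(S) = τ·R(b,S,τ)^(γ−1)·(1−b−S), with γ > 1, τ > 0, 0 ≤ b < 1, h > 0. Let c > 0 and suppose S*, S^SE ∈ (0, 1−b) satisfy F(S*) = h and (1 + c)·F(S^SE) = h. Then S^SE > S*. -/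
theorem stmt17 (γ τ b h c S₁ S₂ : ℝ) (hγ : 1 < γ) (hτ : 0 < τ) (hb0 : 0 ≤ b) (hb1 : b < 1)
    (hh : 0 < h) (hc : 0 < c)
    (hS1 : S₁ ∈ Set.Ioo 0 (1 - b)) (hS2 : S₂ ∈ Set.Ioo 0 (1 - b))
    (e1 : τ * R b S₁ τ ^ (γ - 1) * (1 - b - S₁) = h)
    (e2 : (1 + c) * (τ * R b S₂ τ ^ (γ - 1) * (1 - b - S₂)) = h) :
    S₁ < S₂ := by
  by_contra hlt
  have hle : S₂ ≤ S₁ := not_lt.mp hlt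
  obtain ⟨h1, h1'⟩ := hS1
  obtain ⟨h2, h2'⟩ := hS2
  have hR : R b S₁ τ ≤ R b S₂ τ := by
    unfold R
    apply Real.exp_le_exp.mpr
    have : (1 - b - S₁) ^ 2 ≤ (1 - b - S₂) ^ 2 :=
      pow_le_pow_left₀ (by linarith) (by linarith) 2
    apply mul_le_mul_of_nonneg_left _ (by linarith)
    linarith
  have hR0 : 0 < R b S₁ τ := Real.exp_pos _
  have hp : R b S₁ τ ^ (γ - 1) ≤ R b S₂ τ ^ (γ - 1) :=
    Real.rpow_le_rpow hR0.le hR (by linarith)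
  have hp0 : 0 < R b S₁ τ ^ (γ - 1) := Real.rpow_pos_of_pos hR0 _
  have hF : τ * R b S₁ τ ^ (γ - 1) * (1 - b - S₁) ≤ τ * R b S₂ τ ^ (γ - 1) * (1 - b - S₂) :=
    mul_le_mul (mul_le_mul_of_nonneg_left hp hτ.le) (by linarith) (by linarith)
      (mul_nonneg hτ.le (hp0.le.trans hp))
  nlinarith
end

section
/- Let γ > 1, h > 0, and 0 ≤ b < 1 be real numbers. For τ > 0 and r > 0 with h/(τ·r^(γ−1)) < 1 − b, define S(τ, r) = 1 − b − h/(τ·r^(γ−1)), and for t ∈ ℝ define σ(t, τ, r) = (b + S(τ, r) − t)/S(τ, r). Then: (i) for fixed (τ, r), the partial derivative of σ with respect to t equals −1/S(τ, r) < 0; (ii) for fixed (t, r) with t > b, the partial derivative of σ with respect to τ equals ((t − b)/S(τ, r)²)·(h/(τ²·r^(γ−1))) and is strictly positive; (iii) for fixed (t, τ) with t > b, the partial derivative of σ with respect to r equals ((t − b)/S(τ, r)²)·(h·(γ−1)/(τ·r^γ)) and is strictly positive. -/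
noncomputable def Sz (γ h b τ r : ℝ) : ℝ := 1 - b - h / (τ * r ^ (γ - 1))

noncomputable def sep (γ h b t τ r : ℝ) : ℝ := (b + Sz γ h b τ r - t) / Sz γ h b τ r

theorem sep_aux (f : ℝ → ℝ) (f' b t x : ℝ) (hf : HasDerivAt f f' x) (h0 : f x ≠ 0) :
    HasDerivAt (fun y => (b + f y - t) / f y) ((t - b) / f x ^ 2 * f') x := by
  have h1 := ((hf.const_add b).sub_const t).div hf h0
  refine h1.congr_deriv ?_
  field_simp
  ring

theorem stmt18 (γ h b τ r : ℝ) (hγ : 1 < γ) (hh : 0 < h) (hb0 : 0 ≤ b) (hb1 : b < 1)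
    (hτ : 0 < τ) (hr : 0 < r) (hdom : h / (τ * r ^ (γ - 1)) < 1 - b) :
    (∀ t : ℝ, HasDerivAt (fun t' => sep γ h b t' τ r) (-1 / Sz γ h b τ r) t ∧
      -1 / Sz γ h b τ r < 0) ∧
    (∀ t : ℝ, b < t →
      HasDerivAt (fun τ' => sep γ h b t τ' r)
        ((t - b) / Sz γ h b τ r ^ 2 * (h / (τ ^ 2 * r ^ (γ - 1)))) τ ∧
      0 < (t - b) / Sz γ h b τ r ^ 2 * (h / (τ ^ 2 * r ^ (γ - 1)))) ∧
    (∀ t : ℝ, b < t →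
      HasDerivAt (fun r' => sep γ h b t τ r')
        ((t - b) / Sz γ h b τ r ^ 2 * (h * (γ - 1) / (τ * r ^ γ))) r ∧
      0 < (t - b) / Sz γ h b τ r ^ 2 * (h * (γ - 1) / (τ * r ^ γ))) := by
  have hS : 0 < Sz γ h b τ r := by unfold Sz; linarith
  have hp : 0 < r ^ (γ - 1) := Real.rpow_pos_of_pos hr _
  have hp' : 0 < r ^ γ := Real.rpow_pos_of_pos hr _
  have hg : 0 < γ - 1 := by linarith
  refine ⟨fun t => ⟨?_, ?_⟩, fun t ht => ⟨?_, ?_⟩, fun t ht => ⟨?_, ?_⟩⟩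
  · exact ((hasDerivAt_id t).const_sub (b + Sz γ h b τ r)).div_const _
  · exact div_neg_of_neg_of_pos (by norm_num) hS
  · refine sep_aux (fun τ' => Sz γ h b τ' r) _ b t τ ?_ hS.ne'
    have h1 := (((hasDerivAt_const τ h).div ((hasDerivAt_id τ).mul_const (r ^ (γ - 1)))
      (mul_pos hτ hp).ne').const_sub (1 - b))
    refine h1.congr_deriv ?_
    simp only [id]
    field_simp
    ring
  · have : 0 < t - b := by linarith
    positivity
  · refine sep_aux (fun r' => Sz γ h b τ r') _ b t r ?_ hS.ne'
    have h1 := (((hasDerivAt_const r h).div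
      ((Real.hasDerivAt_rpow_const (p := γ - 1) (Or.inl hr.ne')).const_mul τ)
      (mul_pos hτ hp).ne').const_sub (1 - b))
    refine h1.congr_deriv ?_
    have e1 : r ^ γ = r ^ (γ - 1) * r := by
      rw [Real.rpow_sub_one hr.ne']; field_simp
    rw [e1, Real.rpow_sub_one hr.ne' (γ - 1)]
    field_simp
    ring
  · have : 0 < t - b := by linarith
    positivity
end

section
/- Let γ > 1, h > 0, 0 ≤ b < 1, and let t > b be real numbers. For τ > 0 and r > 0 with h/(τ·r^(γ−1)) < 1 − b, define S(τ, r) = 1 − b − h/(τ·r^(γ−1)) and σ_τ(τ, r) = ((t − b)/S(τ, r)²)·(h/(τ²·r^(γ−1))). Then for fixed τ, the partial derivative of σ_τ with respect to r is strictly negative. -/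
theorem stmt19 (γ h b t τ r : ℝ) (hγ : 1 < γ) (hh : 0 < h) (hb0 : 0 ≤ b) (hb1 : b < 1)
    (ht : b < t) (hτ : 0 < τ) (hr : 0 < r) (hdom : h / (τ * r ^ (γ - 1)) < 1 - b) :
    deriv (fun r' => (t - b) / (1 - b - h / (τ * r' ^ (γ - 1))) ^ 2 *
      (h / (τ ^ 2 * r' ^ (γ - 1)))) r < 0 := by
  have hp : 0 < r ^ (γ - 1) := Real.rpow_pos_of_pos hr _
  have hd : HasDerivAt (fun x : ℝ => x ^ (γ - 1)) ((γ - 1) * r ^ (γ - 1 - 1)) r :=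
    Real.hasDerivAt_rpow_const (Or.inl hr.ne')
  have hq : 0 < (γ - 1) * r ^ (γ - 1 - 1) :=
    mul_pos (by linarith) (Real.rpow_pos_of_pos hr _)
  generalize (γ - 1) * r ^ (γ - 1 - 1) = q at hd hq
  have hS : 0 < 1 - b - h / (τ * r ^ (γ - 1)) := by linarith
  have h1 := (hasDerivAt_const r h).fun_div (hd.const_mul τ) (by positivity)
  have h2 := (hasDerivAt_const r h).fun_div (hd.const_mul (τ ^ 2)) (by positivity)
  have h3 := (hasDerivAt_const r (t - b)).fun_div ((h1.const_sub (1 - b)).fun_pow 2)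
    (pow_pos hS 2).ne'
  have h4 := h3.fun_mul h2
  rw [h4.deriv]
  generalize r ^ (γ - 1) = p at *
  generalize 1 - b - h / (τ * p) = S at *
  have htb : 0 < t - b := by linarith
  generalize t - b = c at *
  have e : (0 * S ^ 2 - c * (((2 : ℕ) : ℝ) * S ^ (2 - 1) * -((0 * (τ * p) - h * (τ * q)) / (τ * p) ^ 2))) /
      (S ^ 2) ^ 2 * (h / (τ ^ 2 * p)) + c / S ^ 2 * ((0 * (τ ^ 2 * p) - h * (τ ^ 2 * q)) / (τ ^ 2 * p) ^ 2)
      = -(c * (2 * S * (h * (τ * q) / (τ * p) ^ 2)) / (S ^ 2) ^ 2 * (h / (τ ^ 2 * p))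
        + c / S ^ 2 * (h * (τ ^ 2 * q) / (τ ^ 2 * p) ^ 2)) := by
    norm_num
    ring
  rw [e]
  have : 0 < c * (2 * S * (h * (τ * q) / (τ * p) ^ 2)) / (S ^ 2) ^ 2 * (h / (τ ^ 2 * p))
        + c / S ^ 2 * (h * (τ ^ 2 * q) / (τ ^ 2 * p) ^ 2) := by positivity
  linarith
end
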